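/- Suppose 0 < γ' ≤ γ_n ≤ γ < 1 for all n ≥ 0, and let {(x_n, y_n)}_{n=0}^∞ be a solution of the system with positive initial conditions. Then for each i ≥ 0, the limit lim_{n→∞} φ(i,n) exists and equals w_i; that is, the infinite series Σ_{k=1}^∞ μ(i,k) x_{i+k} converges to (x_i + γ_{i-1}) / y_i. -/

import Mathlib

open Filter Topology

/-- The coefficient sequence extended to `ℤ` by the convention `γ₋₁ := γ₀`. -/
noncomputable def gext (γ : ℕ → ℝ) : ℤ → ℝ := fun j => if j < 0 then γ 0 else γ j.toNat

/-- `μ(i,1) = 1` and `μ(i,k) = ∏_{j=i-1}^{i+k-3} γ_j` for `k ≥ 2`. -/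
noncomputable def mu (γ : ℕ → ℝ) (i k : ℕ) : ℝ :=
  ∏ t ∈ Finset.range (k - 1), gext γ ((i : ℤ) - 1 + (t : ℤ))

/-- `φ(i,n) = ∑_{k=1}^n μ(i,k) x_{i+k}`. -/
noncomputable def phi (γ x : ℕ → ℝ) (i n : ℕ) : ℝ :=
  ∑ k ∈ Finset.Icc 1 n, mu γ i k * x (i + k)

/-- `w_n = (γ_{n-1} + x_n)/y_n`, where `γ₋₁ := γ₀` (Nat subtraction). -/
noncomputable def wseq (γ x y : ℕ → ℝ) (n : ℕ) : ℝ := (γ (n - 1) + x n) / y n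

theorem gext_natCast_sub_one (γ : ℕ → ℝ) (n : ℕ) : gext γ ((n : ℤ) - 1) = γ (n - 1) := by
  cases n with
  | zero => simp [gext]
  | succ m =>
    have h : ¬ (m : ℤ) < 0 := by omega
    simp [gext, h]

theorem mu_one (γ : ℕ → ℝ) (i : ℕ) : mu γ i 1 = 1 := by
  simp [mu]

theorem mu_add_two (γ : ℕ → ℝ) (i n : ℕ) :
    mu γ i (n + 2) = mu γ i (n + 1) * γ (i + n - 1) := by
  have h : (i : ℤ) - 1 + (n : ℤ) = ((i + n : ℕ) : ℤ) - 1 := by push_cast; ring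
  simp only [mu, Nat.add_sub_cancel, show n + 2 - 1 = n + 1 from rfl]
  rw [Finset.prod_range_succ, h, gext_natCast_sub_one]

theorem mu_succ_pos {γ : ℕ → ℝ} (hγ : ∀ n, 0 < γ n) (i n : ℕ) : 0 < mu γ i (n + 1) := by
  induction n with
  | zero => simp [mu_one]
  | succ n ih => rw [mu_add_two]; exact mul_pos ih (hγ _)

theorem mu_succ_le_pow {γ : ℕ → ℝ} {g : ℝ} (hγ : ∀ n, 0 < γ n) (hg : ∀ n, γ n ≤ g)
    (i n : ℕ) : mu γ i (n + 1) ≤ g ^ n := by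
  induction n with
  | zero => simp [mu_one]
  | succ n ih =>
    rw [mu_add_two, pow_succ]
    exact mul_le_mul ih (hg _) (hγ _).le (pow_nonneg ((hγ 0).le.trans (hg 0)) _)

theorem solution_pos {γ x y : ℕ → ℝ} (hγ : ∀ n, 0 < γ n) (hx0 : 0 < x 0) (hy0 : 0 < y 0)
    (hx : ∀ n, x (n + 1) = x n / y n) (hy : ∀ n, y (n + 1) = x n + γ n * y n) (n : ℕ) :
    0 < x n ∧ 0 < y n := by
  induction n with
  | zero => exact ⟨hx0, hy0⟩
  | succ n ih =>
    rw [hx, hy]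
    exact ⟨div_pos ih.1 ih.2, add_pos ih.1 (mul_pos (hγ n) ih.2)⟩

/-- Along a solution, `y` cannot tend to `0`: once `y < 1`, `x` increases and bounds `y` below. -/
theorem not_tendsto_zero_of_solution {γ x y : ℕ → ℝ} (hγ : ∀ n, 0 < γ n)
    (hxpos : ∀ n, 0 < x n) (hypos : ∀ n, 0 < y n)
    (hx : ∀ n, x (n + 1) = x n / y n) (hy : ∀ n, y (n + 1) = x n + γ n * y n) :
    ¬ Tendsto y atTop (𝓝 0) := by
  intro h
  obtain ⟨M, hM⟩ := eventually_atTop.1 (h.eventually (gt_mem_nhds one_pos))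
  have hmono : ∀ n, M ≤ n → x M ≤ x n := by
    intro n hn
    induction n, hn using Nat.le_induction with
    | base => exact le_rfl
    | succ n hn ih =>
      rw [hx]
      exact ih.trans (le_div_self (hxpos n).le (hypos n) (hM n hn).le)
  obtain ⟨N, hN⟩ := eventually_atTop.1 (h.eventually (gt_mem_nhds (hxpos M)))
  have hlt := hN (max M N + 1) (by omega)
  rw [hy] at hlt
  have := hmono (max M N) (le_max_left _ _)
  have := mul_pos (hγ (max M N)) (hypos (max M N))
  linarith

theorem wseq_succ {γ x y : ℕ → ℝ} (hγ : ∀ n, 0 < γ n)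
    (hxpos : ∀ n, 0 < x n) (hypos : ∀ n, 0 < y n)
    (hx : ∀ n, x (n + 1) = x n / y n) (hy : ∀ n, y (n + 1) = x n + γ n * y n) (n : ℕ) :
    wseq γ x y (n + 1) = 1 / y n := by
  have h1 := (hypos n).ne'
  have h2 : x n + γ n * y n ≠ 0 := (add_pos (hxpos n) (mul_pos (hγ n) (hypos n))).ne'
  rw [wseq, hx, hy, Nat.add_sub_cancel, div_eq_div_iff h2 h1]
  field_simp
  ring

theorem wseq_eq_add {γ x y : ℕ → ℝ} (hγ : ∀ n, 0 < γ n)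
    (hxpos : ∀ n, 0 < x n) (hypos : ∀ n, 0 < y n)
    (hx : ∀ n, x (n + 1) = x n / y n) (hy : ∀ n, y (n + 1) = x n + γ n * y n) (n : ℕ) :
    wseq γ x y n = x (n + 1) + γ (n - 1) * wseq γ x y (n + 1) := by
  rw [wseq_succ hγ hxpos hypos hx hy, hx, wseq]
  ring

theorem wseq_eq_phi_add {γ x y : ℕ → ℝ} (hγ : ∀ n, 0 < γ n)
    (hxpos : ∀ n, 0 < x n) (hypos : ∀ n, 0 < y n)
    (hx : ∀ n, x (n + 1) = x n / y n) (hy : ∀ n, y (n + 1) = x n + γ n * y n) (i n : ℕ) :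
    wseq γ x y i = phi γ x i n + mu γ i (n + 1) * wseq γ x y (i + n) := by
  induction n with
  | zero => simp [phi, mu_one]
  | succ n ih =>
    have hphi : phi γ x i (n + 1) = phi γ x i n + mu γ i (n + 1) * x (i + (n + 1)) :=
      Finset.sum_Icc_succ_top (by omega) _
    rw [ih, hphi, mu_add_two, wseq_eq_add hγ hxpos hypos hx hy (i + n), ← add_assoc i n 1]
    ring

theorem tendsto_mu_mul_wseq {γ x y : ℕ → ℝ} {g : ℝ} (hγ : ∀ n, 0 < γ n)
    (hγhi : ∀ n, γ n ≤ g) (hg : g < 1) (hxpos : ∀ n, 0 < x n) (hypos : ∀ n, 0 < y n)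
    (hx : ∀ n, x (n + 1) = x n / y n) (hy : ∀ n, y (n + 1) = x n + γ n * y n) (i : ℕ) :
    Tendsto (fun n => mu γ i (n + 1) * wseq γ x y (i + n)) atTop (𝓝 0) := by
  set R : ℕ → ℝ := fun n => mu γ i (n + 1) * wseq γ x y (i + n) with hR
  have hg0 : 0 ≤ g := (hγ 0).le.trans (hγhi 0)
  have hanti : Antitone R := by
    refine antitone_nat_of_succ_le fun n => ?_
    simp only [hR]
    rw [mu_add_two, wseq_eq_add hγ hxpos hypos hx hy (i + n), ← add_assoc i n 1]
    linarith [mul_pos (mu_succ_pos hγ i n) (hxpos (i + n + 1))]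
  have hnonneg : ∀ n, 0 ≤ R n := fun n =>
    mul_nonneg (mu_succ_pos hγ i n).le
      (div_nonneg (add_pos (hγ _) (hxpos _)).le (hypos _).le)
  have hsmall : ∀ ε > 0, ∃ N, R N < ε := by
    intro ε hε
    by_contra! hbig
    refine not_tendsto_zero_of_solution hγ hxpos hypos hx hy ?_
    rw [← tendsto_add_atTop_iff_nat i]
    have hpow : Tendsto (fun n : ℕ => g ^ (n + 1) / ε) atTop (𝓝 0) := by
      simpa using (((tendsto_pow_atTop_nhds_zero_of_lt_one hg0 hg).comp
        (tendsto_add_atTop_nat 1)).div_const ε)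
    refine squeeze_zero (fun n => (hypos _).le) (fun n => ?_) hpow
    have h : ε ≤ mu γ i (n + 1 + 1) * (1 / y (n + i)) := by
      rw [← wseq_succ hγ hxpos hypos hx hy, show n + i + 1 = i + (n + 1) by ring]
      exact hbig (n + 1)
    rw [mul_one_div, le_div_iff₀ (hypos _)] at h
    rw [le_div_iff₀ hε, mul_comm]
    exact h.trans (mu_succ_le_pow hγ hγhi i (n + 1))
  refine tendsto_order.2 ⟨fun a ha => .of_forall fun n => ha.trans_le (hnonneg n),
    fun ε hε => ?_⟩
  obtain ⟨N, hN⟩ := hsmall ε hε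
  filter_upwards [eventually_ge_atTop N] with n hn using (hanti hn).trans_lt hN

/-- If `0 < γ' ≤ γₙ ≤ g < 1`, then for every solution with positive initial conditions and
each `i`, `lim_{n→∞} φ(i,n)` exists and equals `wᵢ = (xᵢ + γ_{i-1})/yᵢ`. -/
theorem stmt4 (γ x y : ℕ → ℝ) (γ' g : ℝ)
    (hγ' : 0 < γ') (hγlo : ∀ n, γ' ≤ γ n) (hγhi : ∀ n, γ n ≤ g) (hg : g < 1)
    (hγpos : ∀ n, 0 < γ n)
    (hx0 : 0 < x 0) (hy0 : 0 < y 0)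
    (hx : ∀ n, x (n + 1) = x n / y n)
    (hy : ∀ n, y (n + 1) = x n + γ n * y n) :
    ∀ i : ℕ, Filter.Tendsto (fun n => phi γ x i n) Filter.atTop (nhds (wseq γ x y i)) := by
  intro i
  have hpos := solution_pos hγpos hx0 hy0 hx hy
  have hxpos : ∀ n, 0 < x n := fun n => (hpos n).1
  have hypos : ∀ n, 0 < y n := fun n => (hpos n).2
  have hphi : (fun n => phi γ x i n) =
      fun n => wseq γ x y i - mu γ i (n + 1) * wseq γ x y (i + n) := by
    funext n
    rw [eq_sub_iff_add_eq]
    exact (wseq_eq_phi_add hγpos hxpos hypos hx hy i n).symm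
  rw [hphi]
  simpa using (tendsto_mu_mul_wseq hγpos hγhi hg hxpos hypos hx hy i).const_sub (wseq γ x y i)
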